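/- Buffon's needle probability: for real numbers 0 < l ≤ t, the two-dimensional Lebesgue measure of the set {(x, θ) ∈ [0, t/2] × [0, π] : x ≤ (l/2) · sin θ} equals l, and hence its ratio to the measure of the full rectangle [0, t/2] × [0, π] equals 2l / (t·π). Consequently, the probability that a needle of length l dropped uniformly at random on a plane ruled with parallel lines at spacing t crosses a line is 2l / (t·π). -/

import Mathlib

open MeasureTheory Real

/-- The crossing region for a needle of length `l ≤ t` has area `l`. -/
theorem volume_buffon_crossing (l t : ℝ) (hl : 0 < l) (hlt : l ≤ t) :
    volume {p : ℝ × ℝ | p ∈ Set.Icc (0 : ℝ) (t / 2) ×ˢ Set.Icc (0 : ℝ) Real.pi ∧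
        p.1 ≤ (l / 2) * Real.sin p.2} = ENNReal.ofReal l := by
  have hmeas : MeasurableSet {p : ℝ × ℝ |
      p ∈ Set.Icc (0 : ℝ) (t / 2) ×ˢ Set.Icc (0 : ℝ) Real.pi ∧
        p.1 ≤ (l / 2) * Real.sin p.2} :=
    (measurableSet_Icc.prod measurableSet_Icc).inter
      (measurableSet_le measurable_fst (by fun_prop))
  have hslice (θ : ℝ) : volume ((fun x : ℝ => (x, θ)) ⁻¹' {p : ℝ × ℝ |
      p ∈ Set.Icc (0 : ℝ) (t / 2) ×ˢ Set.Icc (0 : ℝ) Real.pi ∧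
        p.1 ≤ (l / 2) * Real.sin p.2}) =
      (Set.Icc 0 Real.pi).indicator (fun θ => ENNReal.ofReal (l / 2 * Real.sin θ)) θ := by
    by_cases hθ : θ ∈ Set.Icc 0 Real.pi
    · have hle : l / 2 * Real.sin θ ≤ t / 2 := by
        nlinarith [Real.sin_le_one θ]
      rw [Set.indicator_of_mem hθ, ← sub_zero (l / 2 * Real.sin θ), ← Real.volume_Icc]
      congr 1
      ext x
      simp only [Set.mem_preimage, Set.mem_ofPred_eq, Set.mem_prod, Set.mem_Icc] at hθ ⊢
      exact ⟨fun h => ⟨h.1.1.1, h.2⟩, fun h => ⟨⟨⟨h.1, h.2.trans hle⟩, hθ⟩, h.2⟩⟩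
    · rw [Set.indicator_of_notMem hθ]
      convert measure_empty (μ := (volume : Measure ℝ))
      ext x
      simp only [Set.mem_preimage, Set.mem_ofPred_eq, Set.mem_prod, Set.mem_empty_iff_false,
        iff_false]
      exact fun h => hθ h.1.2
  rw [Measure.volume_eq_prod, Measure.prod_apply_symm hmeas]
  simp_rw [hslice]
  rw [lintegral_indicator measurableSet_Icc, ← ofReal_integral_eq_lintegral_ofReal]
  · rw [integral_Icc_eq_integral_Ioc, ← intervalIntegral.integral_of_le Real.pi_pos.le,
      intervalIntegral.integral_const_mul, integral_sin]
    congr 1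
    simp only [Real.cos_zero, Real.cos_pi]
    ring
  · exact ContinuousOn.integrableOn_Icc (by fun_prop)
  · filter_upwards [ae_restrict_mem measurableSet_Icc] with θ hθ
    exact mul_nonneg (by positivity) (Real.sin_nonneg_of_mem_Icc hθ)

theorem buffon_needle (l t : ℝ) (hl : 0 < l) (hlt : l ≤ t) :
    volume {p : ℝ × ℝ | p ∈ Set.Icc (0 : ℝ) (t / 2) ×ˢ Set.Icc (0 : ℝ) Real.pi ∧
        p.1 ≤ (l / 2) * Real.sin p.2} = ENNReal.ofReal l ∧
    volume {p : ℝ × ℝ | p ∈ Set.Icc (0 : ℝ) (t / 2) ×ˢ Set.Icc (0 : ℝ) Real.pi ∧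
          p.1 ≤ (l / 2) * Real.sin p.2} /
        volume (Set.Icc (0 : ℝ) (t / 2) ×ˢ Set.Icc (0 : ℝ) Real.pi) =
      ENNReal.ofReal (2 * l / (t * Real.pi)) := by
  have ht : 0 < t := hl.trans_le hlt
  refine ⟨volume_buffon_crossing l t hl hlt, ?_⟩
  rw [volume_buffon_crossing l t hl hlt, Measure.volume_eq_prod, Measure.prod_prod,
    Real.volume_Icc, Real.volume_Icc, sub_zero, sub_zero,
    ← ENNReal.ofReal_mul (by positivity), ← ENNReal.ofReal_div_of_pos (by positivity)]
  congr 1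
  field_simp
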